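/- Let a and b be coprime integers and set β₁ʳ := b·β₁ − a·β₂ ∈ ℝ². Then the line {K + ℓ·β₁ʳ : ℓ ∈ ℝ} intersects the shifted reciprocal lattice K' + Λ* if and only if 3 divides a − b. (The rational interface direction a e₁ + b e₂ is of armchair type exactly when 3 ∣ a − b, and of zigzag type otherwise.) -/

import Mathlib

open Real

noncomputable section

def β₁ : Fin 2 → ℝ := ![1 / Real.sqrt 3, -1]
def β₂ : Fin 2 → ℝ := ![1 / Real.sqrt 3, 1]

/-- The reciprocal lattice Λ* = {2π n₁ β₁ + 2π n₂ β₂ : n₁, n₂ ∈ ℤ}. -/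
def Λstar : Set (Fin 2 → ℝ) :=
  {v | ∃ n₁ n₂ : ℤ, v = (2 * π * (n₁ : ℝ)) • β₁ + (2 * π * (n₂ : ℝ)) • β₂}

/-- The high symmetry point K = 2π (1/√3, 1/3). -/
def Kpt : Fin 2 → ℝ := ![2 * π / Real.sqrt 3, 2 * π / 3]

/-- K' = −K. -/
def Kpt' : Fin 2 → ℝ := -Kpt

/-- Coordinates in the basis `β₁, β₂` of the condition that a point of the line through `K` lies in
`K' + Λ*`. -/
theorem Kpt_add_smul_eq_iff (a b ℓ m n : ℝ) :
    Kpt + ℓ • (b • β₁ - a • β₂) = Kpt' + ((2 * π * m) • β₁ + (2 * π * n) • β₂) ↔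
      ℓ * b = 2 * π * (m - 2 / 3) ∧ -(ℓ * a) = 2 * π * (n - 4 / 3) := by
  have hs : (1 / Real.sqrt 3) ≠ 0 := by positivity
  have hK : 2 * π / Real.sqrt 3 = 2 * π * (1 / Real.sqrt 3) := by ring
  simp only [funext_iff, Fin.forall_fin_two, Kpt', Kpt, β₁, β₂, Pi.add_apply, Pi.smul_apply,
    Pi.sub_apply, Pi.neg_apply, smul_eq_mul, Matrix.cons_val_zero, Matrix.cons_val_one, hK]
  generalize 1 / Real.sqrt 3 = s at hs
  constructor
  · rintro ⟨h₀, h₁⟩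
    have h : 4 * π + ℓ * (b - a) = 2 * π * (m + n) :=
      mul_right_cancel₀ hs (by linear_combination h₀)
    constructor
    · linear_combination h / 2 - h₁ / 2
    · linear_combination h / 2 + h₁ / 2
  · rintro ⟨h₀, h₁⟩
    constructor
    · linear_combination s * h₀ + s * h₁
    · linear_combination h₁ - h₀

theorem stmt_8 (a b : ℤ) (hab : Int.gcd a b = 1) :
    (∃ ℓ : ℝ, ∃ q ∈ Λstar,
        Kpt + ℓ • ((b : ℝ) • β₁ - (a : ℝ) • β₂) = Kpt' + q) ↔
      (3 : ℤ) ∣ (a - b) := by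
  have hπ : 2 * π ≠ 0 := by positivity
  constructor
  · rintro ⟨ℓ, q, ⟨m, n, rfl⟩, h⟩
    obtain ⟨h₀, h₁⟩ := (Kpt_add_smul_eq_iff _ _ _ _ _).1 h
    have hR : (3 * (a * m + b * n) : ℝ) = 2 * a + 4 * b :=
      mul_left_cancel₀ hπ (by linear_combination -3 * (a : ℝ) * h₀ - 3 * (b : ℝ) * h₁)
    have hZ : 3 * (a * m + b * n) = 2 * a + 4 * b := by exact_mod_cast hR
    omega
  · rintro ⟨k, hk⟩
    have hbez : a * Int.gcdA a b + b * Int.gcdB a b = 1 := by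
      rw [← Int.gcd_eq_gcd_ab, hab, Nat.cast_one]
    generalize Int.gcdA a b = u at hbez
    generalize Int.gcdB a b = v at hbez
    have hk' : (a - b : ℝ) = 3 * k := by exact_mod_cast hk
    have hbez' : (a * u + b * v : ℝ) = 1 := by exact_mod_cast hbez
    refine ⟨2 * π * ((4 * u - 2 * v) / 3), _,
      ⟨u * (2 * b + 2 * k), v * (2 * b + 2 * k), rfl⟩, (Kpt_add_smul_eq_iff _ _ _ _ _).2 ?_⟩
    push_cast
    constructor
    · linear_combination (2 * π) * (2 / 3 * u * hk' - 2 / 3 * hbez')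
    · linear_combination (2 * π) * (2 / 3 * v * hk' - 4 / 3 * hbez')
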